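/- Let Γ be a finite simple graph on m vertices with a fixed linear order on its edge set, and let 1 ≤ k ≤ m. Then the number of NBC spanning forests of Γ with exactly k components equals Σ_{B ∈ B_k(Γ)} ∏_i a_1(Γ_i), where the product runs over the blocks B_i of the bond partition B and Γ_i is the induced subgraph of Γ on B_i, with the induced edge order. -/

import Mathlib

/-!
STATEMENT 10: For a finite simple graph Γ on m vertices with a fixed linear edge
order and 1 ≤ k ≤ m, the number of NBC spanning forests of Γ with exactly k
components equals Σ_{B ∈ B_k(Γ)} ∏_i a_1(Γ_i), the sum over bond partitions with
k blocks of the products of NBC spanning tree counts of the induced subgraphs.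
-/

/-- The edge set of a cycle of the graph `H`. -/
def isCycleEdges {W : Type} [DecidableEq W] (H : SimpleGraph W)
    (C : Finset (Sym2 W)) : Prop :=
  ∃ (v : W) (w : H.Walk v v), w.IsCycle ∧ C = w.edges.toFinset

/-- `B` is a broken circuit of `H` with respect to the edge order `le`. -/
def isBrokenCircuit {W : Type} [DecidableEq W] (H : SimpleGraph W)
    (le : Sym2 W → Sym2 W → Prop) (B : Finset (Sym2 W)) : Prop :=
  ∃ C e, isCycleEdges H C ∧ e ∈ C ∧ (∀ f ∈ C, le f e) ∧ B = C.erase e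

/-- An edge set is NBC if it contains no broken circuit. -/
def isNBC {W : Type} [DecidableEq W] (H : SimpleGraph W)
    (le : Sym2 W → Sym2 W → Prop) (F : Finset (Sym2 W)) : Prop :=
  ∀ B, isBrokenCircuit H le B → ¬ B ⊆ F

/-- An acyclic set of edges of `H`. -/
def isForestIn {W : Type} (H : SimpleGraph W) (F : Finset (Sym2 W)) : Prop :=
  (↑F : Set (Sym2 W)) ⊆ H.edgeSet ∧
    (SimpleGraph.fromEdgeSet (↑F : Set (Sym2 W))).IsAcyclic

/-- A spanning tree of `H`: a set of edges of `H` forming a tree on all vertices. -/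
def isSpanningTreeIn {W : Type} (H : SimpleGraph W) (T : Finset (Sym2 W)) : Prop :=
  (↑T : Set (Sym2 W)) ⊆ H.edgeSet ∧
    (SimpleGraph.fromEdgeSet (↑T : Set (Sym2 W))).IsTree

/-- `a1 H le` is the number of spanning trees of `H` containing no broken circuit. -/
noncomputable def a1 {W : Type} [DecidableEq W] (H : SimpleGraph W)
    (le : Sym2 W → Sym2 W → Prop) : ℕ :=
  Nat.card {T : Finset (Sym2 W) // isSpanningTreeIn H T ∧ isNBC H le T}

/-- A setoid (equivalently, a partition of the vertex set) is a bond partition of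
`G` if each of its equivalence classes induces a connected subgraph of `G`. -/
def IsBondPartition {m : ℕ} (G : SimpleGraph (Fin m)) (s : Setoid (Fin m)) : Prop :=
  ∀ c ∈ s.classes, (G.induce c).Connected

open SimpleGraph

variable {V : Type}

/-- The edges of `F` lying inside the vertex set `c`. -/
noncomputable def edgeRestrict (F : Finset (Sym2 V)) (c : Set V) : Finset (Sym2 c) :=
  F.preimage (Sym2.map Subtype.val) (Sym2.map.injective Subtype.val_injective).injOn

theorem mem_edgeRestrict {F : Finset (Sym2 V)} {c : Set V} {t : Sym2 c} :
    t ∈ edgeRestrict F c ↔ t.map Subtype.val ∈ F := by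
  simp [edgeRestrict]

theorem fromEdgeSet_edgeRestrict (F : Finset (Sym2 V)) (c : Set V) :
    fromEdgeSet (↑(edgeRestrict F c) : Set (Sym2 c)) =
      (fromEdgeSet (↑F : Set (Sym2 V))).induce c := by
  ext x y
  simp [mem_edgeRestrict, Subtype.ext_iff]

/-- Each edge of `F` joins two vertices equivalent under `s`. -/
def EdgesWithin (s : Setoid V) (F : Finset (Sym2 V)) : Prop :=
  ∀ u v, s(u, v) ∈ F → s u v

theorem edgesWithin_reachableSetoid (F : Finset (Sym2 V)) :
    EdgesWithin (fromEdgeSet (↑F : Set (Sym2 V))).reachableSetoid F := by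
  intro u v h
  by_cases huv : u = v
  · exact huv ▸ Reachable.refl u
  · exact Adj.reachable (by simpa [huv] using h)

/-- An edge between equivalent vertices lies in an equivalence class. -/
theorem exists_map_val_eq {s : Setoid V} {F : Finset (Sym2 V)} (h : EdgesWithin s F)
    {e : Sym2 V} (he : e ∈ F) :
    ∃ c ∈ s.classes, ∃ t : Sym2 c, t.map Subtype.val = e := by
  induction e with
  | h u v =>
    exact ⟨_, s.mem_classes v, s(⟨u, h u v he⟩, ⟨v, s.refl' v⟩), rfl⟩

/-- The equivalence class containing an edge is unique. -/
theorem class_eq_of_map_val_eq {s : Setoid V} {c d : Set V} (hc : c ∈ s.classes)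
    (hd : d ∈ s.classes) {t : Sym2 c} {u : Sym2 d}
    (h : t.map Subtype.val = u.map Subtype.val) : c = d := by
  induction t with
  | h x y =>
    have hx : x.1 ∈ u.map Subtype.val := h ▸ by simp
    obtain ⟨z, -, hz⟩ := Sym2.mem_map.1 hx
    exact Setoid.eq_of_mem_classes hc x.2 hd (hz ▸ z.2)

theorem rel_of_mem_class {s : Setoid V} {c : Set V} (hc : c ∈ s.classes) {x y : V}
    (hx : x ∈ c) (hy : y ∈ c) : s x y :=
  s.rel_iff_exists_classes.2 ⟨c, hc, hx, hy⟩

/-- A walk all of whose edges join equivalent vertices stays in one class. -/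
theorem rel_of_mem_support {s : Setoid V} {H : SimpleGraph V} {u v : V} (w : H.Walk u v)
    (h : ∀ x y, s(x, y) ∈ w.edges → s x y) : ∀ x ∈ w.support, s x u := by
  induction w with
  | nil => intro x hx; simp only [Walk.support_nil, List.mem_singleton] at hx; exact hx ▸ s.refl' _
  | cons a p ih =>
    intro x hx
    rw [Walk.support_cons, List.mem_cons] at hx
    rcases hx with rfl | hx
    · exact s.refl' _
    · exact s.trans' (ih (fun x y hxy => h x y (by simp [hxy])) x hx)
        (s.symm' (h _ _ (by simp)))

theorem rel_of_reachable {s : Setoid V} {F : Finset (Sym2 V)} (h : EdgesWithin s F) {u v : V}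
    (huv : (fromEdgeSet (↑F : Set (Sym2 V))).Reachable u v) : s u v := by
  obtain ⟨w⟩ := huv
  refine s.symm' (rel_of_mem_support w (fun x y hxy => h x y ?_) v w.end_mem_support)
  have := w.edges_subset_edgeSet hxy
  simp only [edgeSet_fromEdgeSet] at this
  exact this.1

/-- A cycle whose edges join equivalent vertices comes from a cycle in a class. -/
theorem exists_cycle_induce {s : Setoid V} {H : SimpleGraph V} {v : V} (w : H.Walk v v)
    (hw : w.IsCycle) (h : ∀ x y, s(x, y) ∈ w.edges → s x y) :
    ∃ c ∈ s.classes, ∃ (x : c) (p : (H.induce c).Walk x x),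
      p.IsCycle ∧ p.edges.map (Sym2.map Subtype.val) = w.edges := by
  have hs : ∀ x ∈ w.support, x ∈ {x | s x v} := rel_of_mem_support w h
  have hmap := Walk.map_induce w hs
  refine ⟨_, s.mem_classes v, _, w.induce {x | s x v} hs, ?_, ?_⟩
  · rw [← Walk.isCycle_map_iff_of_injective (f := (Embedding.induce _).toHom)
      Subtype.val_injective]
    exact (congrArg Walk.IsCycle hmap).mpr hw
  · exact (Walk.edges_map _ _).symm.trans (congrArg Walk.edges hmap)

theorem isSpanningTreeIn_edgeRestrict {G : SimpleGraph V} {F : Finset (Sym2 V)}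
    (hF : isForestIn G F) {c : Set V}
    (hc : c ∈ (fromEdgeSet (↑F : Set (Sym2 V))).reachableSetoid.classes) :
    isSpanningTreeIn (G.induce c) (edgeRestrict F c) := by
  refine ⟨fun t ht => ?_, ?_⟩
  · have := hF.1 (mem_edgeRestrict.1 ht)
    induction t with
    | h x y => simpa using this
  · rw [fromEdgeSet_edgeRestrict]
    obtain ⟨y, rfl⟩ := hc
    have := hF.2.isTree_connectedComponent
      ((fromEdgeSet (↑F : Set (Sym2 V))).connectedComponentMk y)
    have h : ((fromEdgeSet (↑F : Set (Sym2 V))).connectedComponentMk y).supp =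
        {x | (fromEdgeSet (↑F : Set (Sym2 V))).reachableSetoid x y} := by
      ext x
      exact ConnectedComponent.eq
    rw [← h]
    exact this

theorem isForestIn_of_edgeRestrict {G : SimpleGraph V} {s : Setoid V} {F : Finset (Sym2 V)}
    (hF : EdgesWithin s F)
    (h : ∀ c ∈ s.classes, isSpanningTreeIn (G.induce c) (edgeRestrict F c)) :
    isForestIn G F := by
  refine ⟨fun e he => ?_, fun v w hw => ?_⟩
  · obtain ⟨c, hc, t, rfl⟩ := exists_map_val_eq hF he
    have := (h c hc).1 (mem_edgeRestrict.2 he)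
    induction t with
    | h x y => simpa using this
  · obtain ⟨c, hc, x, p, hp, -⟩ := exists_cycle_induce w hw fun x y hxy => hF x y <| by
      have := w.edges_subset_edgeSet hxy
      simp only [edgeSet_fromEdgeSet] at this
      exact this.1
    have := (h c hc).2.isAcyclic
    rw [fromEdgeSet_edgeRestrict] at this
    exact this p hp

theorem reachableSetoid_of_edgeRestrict {G : SimpleGraph V} {s : Setoid V}
    {F : Finset (Sym2 V)} (hF : EdgesWithin s F)
    (h : ∀ c ∈ s.classes, isSpanningTreeIn (G.induce c) (edgeRestrict F c)) :
    (fromEdgeSet (↑F : Set (Sym2 V))).reachableSetoid = s := by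
  ext u v
  refine ⟨fun huv => rel_of_reachable hF huv, fun huv => ?_⟩
  have ht := (h _ (s.mem_classes v)).2.connected
  rw [fromEdgeSet_edgeRestrict] at ht
  exact (ht.preconnected ⟨u, huv⟩ ⟨v, s.refl' v⟩).map (Embedding.induce _).toHom

theorem isBondPartition_of_isForestIn {m : ℕ} {G : SimpleGraph (Fin m)}
    {F : Finset (Sym2 (Fin m))} (hF : isForestIn G F) :
    IsBondPartition G (fromEdgeSet (↑F : Set (Sym2 (Fin m)))).reachableSetoid := by
  intro c hc
  obtain ⟨h₁, h₂⟩ := isSpanningTreeIn_edgeRestrict hF hc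
  refine h₂.connected.mono fun x y hxy => ?_
  exact h₁ ((fromEdgeSet_adj _).1 hxy).1

section NBC

variable [DecidableEq V]

/-- An edge of a cycle has its endpoints connected by the remaining edges. -/
theorem reachable_erase_of_isCycle {H : SimpleGraph V} {v : V} (w : H.Walk v v)
    (hw : w.IsCycle) {x y : V} (h : s(x, y) ∈ w.edges) :
    (fromEdgeSet (↑(w.edges.toFinset.erase s(x, y)) : Set (Sym2 V))).Reachable x y := by
  have hd : ∀ e ∈ w.edges, e ∈ (fromEdgeSet (↑w.edges.toFinset : Set (Sym2 V))).edgeSet := by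
    intro e he
    rw [edgeSet_fromEdgeSet]
    exact ⟨by simpa using he, H.not_isDiag_of_mem_edgeSet (w.edges_subset_edgeSet he)⟩
  have hb := (isBridge_iff_forall_cycle_notMem (hd _ h)).not.2 fun hn =>
    hn (w.transfer _ hd) (hw.transfer hd) (by simpa using h)
  rw [isBridge_iff, not_not] at hb
  refine hb.mono fun a b hab => ?_
  simp only [deleteEdges_adj, fromEdgeSet_adj, Set.mem_singleton_iff] at hab
  rw [fromEdgeSet_adj]
  exact ⟨by simpa [hab.2] using hab.1.1, hab.1.2⟩

/-- A cycle of an induced subgraph is a cycle of the graph. -/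
theorem isCycleEdges_image {G : SimpleGraph V} {c : Set V} {C : Finset (Sym2 c)}
    (h : isCycleEdges (G.induce c) C) :
    isCycleEdges G (C.image (Sym2.map Subtype.val)) := by
  obtain ⟨v, w, hw, rfl⟩ := h
  refine ⟨_, w.map (Embedding.induce c).toHom, hw.map Subtype.val_injective, ?_⟩
  ext e
  simp only [Walk.edges_map, List.mem_toFinset, Finset.mem_image, List.mem_map]
  rfl

theorem isNBC_edgeRestrict {G : SimpleGraph V} {le : Sym2 V → Sym2 V → Prop}
    {F : Finset (Sym2 V)} (hF : isNBC G le F) (c : Set V) :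
    isNBC (G.induce c) (fun e f => le (e.map Subtype.val) (f.map Subtype.val))
      (edgeRestrict F c) := by
  rintro B ⟨C, e, hC, he, hmax, rfl⟩ hsub
  refine hF _ ⟨_, e.map Subtype.val, isCycleEdges_image hC, Finset.mem_image_of_mem _ he, ?_,
    rfl⟩ ?_
  · intro f hf
    obtain ⟨f, hfC, rfl⟩ := Finset.mem_image.1 hf
    exact hmax f hfC
  · intro f hf
    obtain ⟨hne, hf⟩ := Finset.mem_erase.1 hf
    obtain ⟨f, hfC, rfl⟩ := Finset.mem_image.1 hf
    exact mem_edgeRestrict.1 (hsub (Finset.mem_erase.2 ⟨fun h => hne (h ▸ rfl), hfC⟩))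

theorem isNBC_of_edgeRestrict {G : SimpleGraph V} {le : Sym2 V → Sym2 V → Prop}
    {s : Setoid V} {F : Finset (Sym2 V)} (hF : EdgesWithin s F)
    (h : ∀ c ∈ s.classes, isNBC (G.induce c)
      (fun e f => le (e.map Subtype.val) (f.map Subtype.val)) (edgeRestrict F c)) :
    isNBC G le F := by
  rintro B ⟨C, e, ⟨v, w, hw, rfl⟩, he, hmax, rfl⟩ hsub
  have hrel : ∀ x y, s(x, y) ∈ w.edges → s x y := by
    intro x y hxy
    by_cases hex : s(x, y) = e
    · subst hex
      exact rel_of_reachable hF ((reachable_erase_of_isCycle w hw hxy).mono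
        (fromEdgeSet_mono (by exact_mod_cast hsub)))
    · exact hF x y (hsub (Finset.mem_erase.2 ⟨hex, by simpa using hxy⟩))
  obtain ⟨c, hc, x, p, hp, hpw⟩ := exists_cycle_induce w hw hrel
  have hmem : ∀ t ∈ p.edges, t.map Subtype.val ∈ w.edges.toFinset := fun t ht => by
    rw [List.mem_toFinset, ← hpw]
    exact List.mem_map_of_mem ht
  rw [List.mem_toFinset, ← hpw, List.mem_map] at he
  obtain ⟨t, ht, rfl⟩ := he
  refine h c hc _ ⟨_, t, ⟨x, p, hp, rfl⟩, by simpa using ht, ?_, rfl⟩ ?_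
  · exact fun f hf => hmax _ (hmem f (by simpa using hf))
  · intro f hf
    obtain ⟨hne, hf⟩ := Finset.mem_erase.1 hf
    exact mem_edgeRestrict.2 (hsub (Finset.mem_erase.2
      ⟨fun h => hne (Sym2.map.injective Subtype.val_injective h), hmem f (by simpa using hf)⟩))

end NBC

section Counting

variable [Fintype V]

/-- The edge set assembled from edge sets of the equivalence classes. -/
noncomputable def edgeUnion (s : Setoid V) (T : ∀ c : s.classes, Finset (Sym2 c.1)) :
    Finset (Sym2 V) :=
  (Set.toFinite {e | ∃ c : s.classes, ∃ t ∈ T c, t.map Subtype.val = e}).toFinset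

theorem mem_edgeUnion {s : Setoid V} {T : ∀ c : s.classes, Finset (Sym2 c.1)} {e : Sym2 V} :
    e ∈ edgeUnion s T ↔ ∃ c : s.classes, ∃ t ∈ T c, t.map Subtype.val = e := by
  simp [edgeUnion]

theorem edgesWithin_edgeUnion (s : Setoid V) (T : ∀ c : s.classes, Finset (Sym2 c.1)) :
    EdgesWithin s (edgeUnion s T) := by
  intro u v h
  obtain ⟨c, t, -, ht⟩ := mem_edgeUnion.1 h
  have hu : u ∈ t.map Subtype.val := ht ▸ by simp
  have hv : v ∈ t.map Subtype.val := ht ▸ by simp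
  obtain ⟨x, -, rfl⟩ := Sym2.mem_map.1 hu
  obtain ⟨y, -, rfl⟩ := Sym2.mem_map.1 hv
  exact rel_of_mem_class c.2 x.2 y.2

theorem edgeRestrict_edgeUnion (s : Setoid V) (T : ∀ c : s.classes, Finset (Sym2 c.1))
    (c : s.classes) : edgeRestrict (edgeUnion s T) c.1 = T c := by
  ext t
  rw [mem_edgeRestrict, mem_edgeUnion]
  refine ⟨?_, fun h => ⟨c, t, h, rfl⟩⟩
  rintro ⟨d, u, hu, h⟩
  obtain rfl : d = c := Subtype.ext (class_eq_of_map_val_eq d.2 c.2 h)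
  exact Sym2.map.injective Subtype.val_injective h ▸ hu

/-- The number of edges of a forest plus its number of components is the number of vertices. -/
theorem card_add_ncard_classes {G : SimpleGraph V} {F : Finset (Sym2 V)}
    (hF : isForestIn G F) :
    F.card + (fromEdgeSet (↑F : Set (Sym2 V))).reachableSetoid.classes.ncard =
      Fintype.card V := by
  classical
  set s := (fromEdgeSet (↑F : Set (Sym2 V))).reachableSetoid
  have htree (c : s.classes) : (edgeRestrict F c.1).card + 1 = Nat.card c.1 := by
    have h := isSpanningTreeIn_edgeRestrict hF c.2
    rw [Nat.card_eq_fintype_card, ← h.2.card_edgeFinset]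
    congr 2
    ext e
    simp only [mem_edgeFinset, edgeSet_fromEdgeSet]
    exact ⟨fun he => ⟨he, not_isDiag_of_mem_edgeSet _ (h.1 he)⟩, fun he => he.1⟩
  have hedges : F.card = ∑ c : s.classes, (edgeRestrict F c.1).card := by
    have : Function.Bijective
        (fun p : (Σ c : s.classes, {t // t ∈ edgeRestrict F c.1}) =>
          (⟨p.2.1.map Subtype.val, mem_edgeRestrict.1 p.2.2⟩ : {e // e ∈ F})) := by
      constructor
      · rintro ⟨c, t, ht⟩ ⟨d, u, hu⟩ h
        have h : t.map Subtype.val = u.map Subtype.val := congrArg Subtype.val h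
        obtain rfl : c = d := Subtype.ext (class_eq_of_map_val_eq c.2 d.2 h)
        obtain rfl := Sym2.map.injective Subtype.val_injective h
        rfl
      · rintro ⟨e, he⟩
        obtain ⟨c, hc, t, rfl⟩ := exists_map_val_eq (edgesWithin_reachableSetoid F) he
        exact ⟨⟨⟨c, hc⟩, t, mem_edgeRestrict.2 he⟩, rfl⟩
    simpa using (Nat.card_congr (Equiv.ofBijective _ this)).symm
  have hverts : Fintype.card V = ∑ c : s.classes, Nat.card c.1 := by
    have : Function.Bijective (fun p : (Σ c : s.classes, c.1) => p.2.1) := by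
      constructor
      · rintro ⟨c, x, hx⟩ ⟨d, y, hy⟩ (rfl : x = y)
        obtain rfl : c = d := Subtype.ext (Setoid.eq_of_mem_classes c.2 hx d.2 hy)
        rfl
      · exact fun x => ⟨⟨⟨_, s.mem_classes x⟩, x, s.refl' x⟩, rfl⟩
    rw [← Nat.card_eq_fintype_card, ← Nat.card_congr (Equiv.ofBijective _ this), Nat.card_sigma]
  rw [hverts, ← Finset.sum_congr rfl fun c _ => htree c, Finset.sum_add_distrib, ← hedges]
  simp [← Nat.card_coe_set_eq]

/-- NBC forests with prescribed components are counted by the product of the numbers of NBC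
spanning trees of the components. -/
theorem card_isNBC_forest_reachableSetoid_eq [DecidableEq V] (G : SimpleGraph V)
    (le : Sym2 V → Sym2 V → Prop) (s : Setoid V) :
    Nat.card {F : Finset (Sym2 V) // (isForestIn G F ∧ isNBC G le F) ∧
        (fromEdgeSet (↑F : Set (Sym2 V))).reachableSetoid = s} =
      ∏ᶠ c ∈ s.classes,
        a1 (G.induce c) (fun e f => le (e.map Subtype.val) (f.map Subtype.val)) := by
  classical
  rw [← finprod_set_coe_eq_finprod_mem, finprod_eq_prod_of_fintype]
  simp only [a1]
  rw [← Nat.card_pi]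
  refine Nat.card_congr (Equiv.ofBijective (fun F c => ⟨edgeRestrict F.1 c.1,
    isSpanningTreeIn_edgeRestrict F.2.1.1 (by rw [F.2.2]; exact c.2),
    isNBC_edgeRestrict F.2.1.2 c.1⟩) ⟨?_, ?_⟩)
  · have key : ∀ F F' : Finset (Sym2 V), EdgesWithin s F →
        (∀ c : s.classes, edgeRestrict F c.1 = edgeRestrict F' c.1) → F ⊆ F' := by
      intro F F' hF h e he
      obtain ⟨c, hc, t, rfl⟩ := exists_map_val_eq hF he
      exact mem_edgeRestrict.1 (h ⟨c, hc⟩ ▸ mem_edgeRestrict.2 he)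
    rintro ⟨F, hF, hFs⟩ ⟨F', hF', hFs'⟩ h
    have h (c : s.classes) : edgeRestrict F c.1 = edgeRestrict F' c.1 :=
      congrArg Subtype.val (congrFun h c)
    exact Subtype.ext ((key F F' (hFs ▸ edgesWithin_reachableSetoid F) h).antisymm
      (key F' F (hFs' ▸ edgesWithin_reachableSetoid F') fun c => (h c).symm))
  · intro T
    have hw := edgesWithin_edgeUnion s fun c => (T c).1
    have hr := edgeRestrict_edgeUnion s fun c => (T c).1
    have ht : ∀ c ∈ s.classes, isSpanningTreeIn (G.induce c)
        (edgeRestrict (edgeUnion s fun c => (T c).1) c) := fun c hc =>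
      (hr ⟨c, hc⟩).symm ▸ (T ⟨c, hc⟩).2.1
    exact ⟨⟨_, ⟨isForestIn_of_edgeRestrict hw ht, isNBC_of_edgeRestrict hw fun c hc =>
      (hr ⟨c, hc⟩).symm ▸ (T ⟨c, hc⟩).2.2⟩, reachableSetoid_of_edgeRestrict hw ht⟩,
      funext fun c => Subtype.ext (hr c)⟩

end Counting

theorem stmt10 (m k : ℕ) (hk : 1 ≤ k) (hkm : k ≤ m)
    (G : SimpleGraph (Fin m)) (eo : LinearOrder (Sym2 (Fin m))) :
    Nat.card {F : Finset (Sym2 (Fin m)) //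
        isForestIn G F ∧ F.card = m - k ∧ isNBC G eo.le F} =
      ∑ᶠ s ∈ {s : Setoid (Fin m) | IsBondPartition G s ∧ s.classes.ncard = k},
        ∏ᶠ c ∈ s.classes,
          a1 (G.induce c)
            (fun e f => eo.le (e.map Subtype.val) (f.map Subtype.val)) := by
  classical
  have hfin : Finite (Setoid (Fin m)) :=
    Finite.of_injective (fun s : Setoid (Fin m) => s.classes) fun _ _ h => Setoid.classes_inj.2 h
  have := Fintype.ofFinite {s : Setoid (Fin m) | IsBondPartition G s ∧ s.classes.ncard = k}
  rw [← finsum_set_coe_eq_finsum_mem, finsum_eq_sum_of_fintype]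
  have hcard {F : Finset (Sym2 (Fin m))} (hF : isForestIn G F) : F.card = m - k ↔
      (fromEdgeSet (↑F : Set (Sym2 (Fin m)))).reachableSetoid.classes.ncard = k := by
    have := card_add_ncard_classes hF
    rw [Fintype.card_fin] at this
    omega
  let f (F : {F : Finset (Sym2 (Fin m)) //
        isForestIn G F ∧ F.card = m - k ∧ isNBC G eo.le F}) :
      {s : Setoid (Fin m) | IsBondPartition G s ∧ s.classes.ncard = k} :=
    ⟨(fromEdgeSet (↑F.1 : Set (Sym2 (Fin m)))).reachableSetoid,
      isBondPartition_of_isForestIn F.2.1, (hcard F.2.1).1 F.2.2.1⟩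
  rw [← Nat.card_congr (Equiv.sigmaFiberEquiv f), Nat.card_sigma]
  refine Finset.sum_congr rfl fun s _ => ?_
  rw [← card_isNBC_forest_reachableSetoid_eq]
  exact Nat.card_congr
    { toFun := fun F => ⟨F.1.1, ⟨F.1.2.1, F.1.2.2.2⟩, congrArg Subtype.val F.2⟩
      invFun := fun F => ⟨⟨F.1, F.2.1.1, (hcard F.2.1.1).2 (F.2.2.symm ▸ s.2.2), F.2.1.2⟩,
        Subtype.ext F.2.2⟩
      left_inv := fun _ => rfl
      right_inv := fun _ => rfl }
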